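/- arXiv:1102.5132 — 2 statements merged into one kernel-verified Lean document; each statement's English description precedes it below -/
import Mathlib

section
/- τ-quantization of monomials, first form (dimension N = 1): for all natural numbers m, n, every real number τ, and all Schwartz functions ψ, φ on ℝ, ∫_{ℝ²} x^m p^n W_τ(ψ,φ)(x,p) dx dp = Σ_{k=0}^{m} C(m,k) τ^k (1−τ)^{m−k} ∫_ℝ x^k · D^n(y ↦ y^{m−k} ψ(y))(x) · conj(φ(x)) dx, where D denotes the operator −iħ d/dx and C(m,k) is the binomial coefficient. -/
open MeasureTheory Complex

noncomputable section

/-- The one-dimensional `τ`-Wigner transform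
`W_τ(ψ,φ)(x,p) = (2πħ)^{-1} ∫ e^{-i p y/ħ} ψ(x+τy) conj(φ(x-(1-τ)y)) dy`. -/
def Wig1 (hbar τ : ℝ) (ψ φ : ℝ → ℂ) (z : ℝ × ℝ) : ℂ :=
  ((2 * Real.pi * hbar : ℝ) : ℂ)⁻¹ *
    ∫ y : ℝ, Complex.exp (-Complex.I * (z.2 : ℂ) * (y : ℂ) / (hbar : ℂ)) *
      ψ (z.1 + τ * y) * (starRingEnd ℂ) (φ (z.1 - (1 - τ) * y))

/-- The momentum operator `D = -iħ d/dx`. -/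
def Dop (hbar : ℝ) (f : ℝ → ℂ) : ℝ → ℂ :=
  fun x => -Complex.I * (hbar : ℂ) * deriv f x

/-- The function `y ↦ ψ(x+τy) conj(φ(x-(1-τ)y))`. -/
def gsec (τ : ℝ) (ψ φ : SchwartzMap ℝ ℂ) (x y : ℝ) : ℂ :=
  ψ (x + τ * y) * (starRingEnd ℂ) (φ (x - (1 - τ) * y))

lemma gsec_continuous (τ : ℝ) (ψ φ : SchwartzMap ℝ ℂ) :
    Continuous (fun z : ℝ × ℝ => gsec τ ψ φ z.1 z.2) := by
  unfold gsec
  have h1 := ψ.continuous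
  have h2 := φ.continuous
  have h3 := Complex.continuous_conj
  fun_prop

lemma gsec_continuous_right (τ : ℝ) (ψ φ : SchwartzMap ℝ ℂ) (x : ℝ) :
    Continuous (gsec τ ψ φ x) := by
  have := (gsec_continuous τ ψ φ).comp (Continuous.prodMk_right x)
  exact this

lemma schwartz_conj_integrable (φ : SchwartzMap ℝ ℂ) :
    Integrable (fun y => (starRingEnd ℂ) (φ y)) :=
  (LinearIsometryEquiv.integrable_comp_iff (Complex.conjLIE)).2 φ.integrable

lemma schwartz_bdd (φ : SchwartzMap ℝ ℂ) : ∃ C, ∀ x, ‖φ x‖ ≤ C :=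
  ⟨_, fun x => SchwartzMap.norm_le_seminorm ℝ φ x⟩

lemma gsec_integrable (τ : ℝ) (ψ φ : SchwartzMap ℝ ℂ) (x : ℝ) :
    Integrable (gsec τ ψ φ x) := by
  by_cases h : τ = 1
  · subst h
    have h1 : Integrable (fun y : ℝ => ψ (x + y)) := ψ.integrable.comp_add_left x
    have h2 := h1.mul_const ((starRingEnd ℂ) (φ x))
    refine h2.congr (Filter.Eventually.of_forall fun y => ?_)
    simp [gsec]
  · obtain ⟨C, hC⟩ := schwartz_bdd ψ
    have h1 : Integrable (fun y : ℝ => (starRingEnd ℂ) (φ (x - (1 - τ) * y))) := by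
      have := (schwartz_conj_integrable φ).comp_sub_left x
      exact this.comp_mul_left' (sub_ne_zero.2 (Ne.symm h))
    refine h1.bdd_mul (c := C) ?_ ?_
    · exact (ψ.continuous.comp (by fun_prop)).aestronglyMeasurable
    · exact Filter.Eventually.of_forall fun y => hC _

lemma gsec_integrable_prod (τ : ℝ) (ψ φ : SchwartzMap ℝ ℂ) :
    Integrable (fun z : ℝ × ℝ => gsec τ ψ φ z.1 z.2) := by
  have h0 : Integrable (fun z : ℝ × ℝ => ψ z.1 * (starRingEnd ℂ) (φ z.2)) :=
    ψ.integrable.mul_prod (schwartz_conj_integrable φ)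
  have s1 : MeasurePreserving (fun p : ℝ × ℝ => (p.1, p.2 + τ * p.1))
      (volume.prod volume) (volume.prod volume) := by
    refine MeasurePreserving.skew_product (g := fun y x : ℝ => x + τ * y)
      (MeasurePreserving.id volume) (by fun_prop) ?_
    exact Filter.Eventually.of_forall fun y => map_add_right_eq_self volume (τ * y)
  have s2 : MeasurePreserving (fun p : ℝ × ℝ => (p.1, p.1 - p.2))
      (volume.prod volume) (volume.prod volume) := by
    refine MeasurePreserving.skew_product (g := fun u y : ℝ => u - y)
      (MeasurePreserving.id volume) (by fun_prop) ?_
    exact Filter.Eventually.of_forall fun u => Measure.map_sub_left_eq_self volume u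
  have s3 : MeasurePreserving (Prod.swap : ℝ × ℝ → ℝ × ℝ)
      (volume.prod volume) (volume.prod volume) := Measure.measurePreserving_swap
  have s := s2.comp (s3.comp (s1.comp s3))
  have h := s.integrable_comp_of_integrable h0
  refine h.congr (Filter.Eventually.of_forall fun z => ?_)
  simp only [Function.comp, Prod.swap, gsec]
  congr 3
  ring

open FourierTransform in
lemma wig_eq_fourier (hbar τ : ℝ) (hhbar : 0 < hbar) (ψ φ : SchwartzMap ℝ ℂ) (x p : ℝ) :
    Wig1 hbar τ ψ φ (x, p) = ((2 * Real.pi * hbar : ℝ) : ℂ)⁻¹ *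
      𝓕 (gsec τ ψ φ x) (p / (2 * Real.pi * hbar)) := by
  unfold Wig1
  rw [Real.fourier_real_eq_integral_exp_smul]
  congr 1
  refine integral_congr_ae (Filter.Eventually.of_forall fun y => ?_)
  simp only [gsec, smul_eq_mul, mul_assoc]
  congr 2
  have := Real.pi_ne_zero
  have : (hbar : ℂ) ≠ 0 := by exact_mod_cast hhbar.ne'
  have : (Real.pi : ℂ) ≠ 0 := by exact_mod_cast Real.pi_ne_zero
  push_cast
  field_simp

/-- The momentum operator on Schwartz functions. -/
def DS (hbar : ℝ) (f : SchwartzMap ℝ ℂ) : SchwartzMap ℝ ℂ :=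
  (-Complex.I * (hbar : ℂ)) • SchwartzMap.derivCLM ℂ ℂ f

lemma DS_coe (hbar : ℝ) (f : SchwartzMap ℝ ℂ) : ⇑(DS hbar f) = Dop hbar f := by
  ext x
  simp [DS, Dop, SchwartzMap.derivCLM_apply]

lemma DS_iter (hbar : ℝ) (n : ℕ) (f : SchwartzMap ℝ ℂ) :
    (Dop hbar)^[n] f = ⇑((DS hbar)^[n] f) := by
  induction n generalizing f with
  | zero => rfl
  | succ n ih => rw [Function.iterate_succ_apply, Function.iterate_succ_apply, ← DS_coe, ih]

lemma schwartz_hasDerivAt (f : SchwartzMap ℝ ℂ) (x : ℝ) : HasDerivAt f (deriv f x) x :=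
  f.differentiableAt.hasDerivAt

lemma conj_hasDerivAt (f : SchwartzMap ℝ ℂ) (x : ℝ) :
    HasDerivAt (fun y => (starRingEnd ℂ) (f y)) ((starRingEnd ℂ) (deriv f x)) x :=
  (schwartz_hasDerivAt f x).star

lemma gsec_hasDerivAt (hbar τ : ℝ) (hhbar : 0 < hbar) (ψ φ : SchwartzMap ℝ ℂ) (x y : ℝ) :
    HasDerivAt (gsec τ ψ φ x) ((Complex.I / hbar) *
      (τ * gsec τ (DS hbar ψ) φ x y + (1 - τ) * gsec τ ψ (DS hbar φ) x y)) y := by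
  have h1 : HasDerivAt (fun y : ℝ => x + τ * y) τ y := by
    simpa using ((hasDerivAt_id y).const_mul τ).const_add x
  have h2 : HasDerivAt (fun y : ℝ => x - (1 - τ) * y) (-(1 - τ)) y := by
    simpa using ((hasDerivAt_id y).const_mul (1 - τ)).const_sub x
  have h3 := (schwartz_hasDerivAt ψ (x + τ * y)).scomp y h1
  have h4 := (conj_hasDerivAt φ (x - (1 - τ) * y)).scomp y h2
  have h5 := h3.mul h4
  refine h5.congr_deriv ?_
  have hh : (hbar : ℂ) ≠ 0 := by exact_mod_cast hhbar.ne'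
  simp only [gsec, DS_coe, Dop, Function.comp, map_mul, map_neg, Complex.conj_I,
    Complex.conj_ofReal, Complex.real_smul]
  field_simp
  push_cast
  ring_nf
  simp only [Complex.I_sq]
  ring

lemma gsec_deriv_integrable (hbar τ : ℝ) (ψ φ : SchwartzMap ℝ ℂ) (x : ℝ) :
    Integrable (fun y => (Complex.I / hbar) *
      (τ * gsec τ (DS hbar ψ) φ x y + (1 - τ) * gsec τ ψ (DS hbar φ) x y)) :=
  (((gsec_integrable τ (DS hbar ψ) φ x).const_mul _).add
    ((gsec_integrable τ ψ (DS hbar φ) x).const_mul _)).const_mul _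

open FourierTransform in
lemma fourier_add_aux (f g : ℝ → ℂ) (hf : Integrable f) (hg : Integrable g) (a b c : ℂ) (q : ℝ) :
    𝓕 (fun y => c * (a * f y + b * g y)) q = c * (a * 𝓕 f q + b * 𝓕 g q) := by
  have key : ∀ h : ℝ → ℂ, Integrable h → Integrable (fun v : ℝ =>
      Complex.exp (↑(-2 * Real.pi * v * q) * Complex.I) • h v) := by
    intro h hh
    refine hh.bdd_mul (c := 1) ?_ ?_
    · exact Continuous.aestronglyMeasurable (by fun_prop)
    · exact Filter.Eventually.of_forall fun y => (Complex.norm_exp_ofReal_mul_I _).le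
  simp only [Real.fourier_real_eq_integral_exp_smul]
  rw [← integral_const_mul a, ← integral_const_mul b, ← integral_add, ← integral_const_mul]
  · refine integral_congr_ae (Filter.Eventually.of_forall fun y => ?_)
    simp only [smul_eq_mul]
    ring
  · exact (key f hf).const_mul a
  · exact (key g hg).const_mul b

lemma wig_p (hbar τ : ℝ) (hhbar : 0 < hbar) (ψ φ : SchwartzMap ℝ ℂ) (z : ℝ × ℝ) :
    (z.2 : ℂ) * Wig1 hbar τ ψ φ z =
      τ * Wig1 hbar τ (DS hbar ψ) φ z + (1 - τ) * Wig1 hbar τ ψ (DS hbar φ) z := by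
  obtain ⟨x, p⟩ := z
  simp only [wig_eq_fourier hbar τ hhbar]
  have hd : deriv (gsec τ ψ φ x) = fun y => (Complex.I / hbar) *
      (τ * gsec τ (DS hbar ψ) φ x y + (1 - τ) * gsec τ ψ (DS hbar φ) x y) :=
    funext fun y => (gsec_hasDerivAt hbar τ hhbar ψ φ x y).deriv
  have h := Real.fourier_deriv (gsec_integrable τ ψ φ x)
    (fun y => (gsec_hasDerivAt hbar τ hhbar ψ φ x y).differentiableAt)
    (by rw [hd]; exact gsec_deriv_integrable hbar τ ψ φ x)
  have h2 := congrFun h (p / (2 * Real.pi * hbar))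
  rw [hd, fourier_add_aux _ _ (gsec_integrable τ (DS hbar ψ) φ x)
    (gsec_integrable τ ψ (DS hbar φ) x)] at h2
  have hh : (hbar : ℂ) ≠ 0 := by exact_mod_cast hhbar.ne'
  have hp : (Real.pi : ℂ) ≠ 0 := by exact_mod_cast Real.pi_ne_zero
  have hI := Complex.I_ne_zero
  simp only [smul_eq_mul] at h2
  push_cast at h2 ⊢
  field_simp at h2 ⊢
  linear_combination -h2

lemma wig_stronglyMeasurable (hbar τ : ℝ) (ψ φ : SchwartzMap ℝ ℂ) :
    StronglyMeasurable (Wig1 hbar τ ψ φ) := by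
  unfold Wig1
  refine StronglyMeasurable.const_mul ?_ _
  refine StronglyMeasurable.integral_prod_right' (f := fun w : (ℝ × ℝ) × ℝ =>
    Complex.exp (-Complex.I * (w.1.2 : ℂ) * (w.2 : ℂ) / (hbar : ℂ)) *
      ψ (w.1.1 + τ * w.2) * (starRingEnd ℂ) (φ (w.1.1 - (1 - τ) * w.2))) ?_
  have h1 := ψ.continuous
  have h2 := φ.continuous
  have h3 := Complex.continuous_conj
  exact Continuous.stronglyMeasurable (by fun_prop)

lemma wig_bound (hbar τ : ℝ) (ψ φ : SchwartzMap ℝ ℂ) (z : ℝ × ℝ) :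
    ‖Wig1 hbar τ ψ φ z‖ ≤ ‖((2 * Real.pi * hbar : ℝ) : ℂ)⁻¹‖ * ∫ y, ‖gsec τ ψ φ z.1 y‖ := by
  unfold Wig1
  rw [norm_mul]
  refine mul_le_mul_of_nonneg_left ?_ (norm_nonneg _)
  refine (norm_integral_le_integral_norm _).trans (le_of_eq ?_)
  refine integral_congr_ae (Filter.Eventually.of_forall fun y => ?_)
  simp only [gsec, norm_mul]
  have : -Complex.I * (z.2 : ℂ) * (y : ℂ) / (hbar : ℂ) =
      ((-(z.2 * y / hbar) : ℝ) : ℂ) * Complex.I := by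
    push_cast; ring
  rw [this, Complex.norm_exp_ofReal_mul_I, one_mul]

lemma wig_dom (hbar τ : ℝ) (ψ φ : SchwartzMap ℝ ℂ) :
    ∃ B : ℝ → ℝ, Integrable B ∧ ∀ z : ℝ × ℝ, ‖Wig1 hbar τ ψ φ z‖ ≤ B z.1 := by
  refine ⟨fun x => ‖((2 * Real.pi * hbar : ℝ) : ℂ)⁻¹‖ * ∫ y, ‖gsec τ ψ φ x y‖, ?_,
    fun z => wig_bound hbar τ ψ φ z⟩
  exact ((gsec_integrable_prod τ ψ φ).norm.integral_prod_left).const_mul _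

lemma wig_p_dom (hbar τ : ℝ) (hhbar : 0 < hbar) (n : ℕ) (ψ φ : SchwartzMap ℝ ℂ) :
    ∃ B : ℝ → ℝ, Integrable B ∧ ∀ z : ℝ × ℝ, ‖(z.2 : ℂ) ^ n * Wig1 hbar τ ψ φ z‖ ≤ B z.1 := by
  induction n generalizing ψ φ with
  | zero => simpa using wig_dom hbar τ ψ φ
  | succ n ih =>
    obtain ⟨B1, h1, h1'⟩ := ih (DS hbar ψ) φ
    obtain ⟨B2, h2, h2'⟩ := ih ψ (DS hbar φ)
    refine ⟨fun x => ‖(τ : ℂ)‖ * B1 x + ‖(1 - τ : ℂ)‖ * B2 x,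
      (h1.const_mul _).add (h2.const_mul _), fun z => ?_⟩
    have : (z.2 : ℂ) ^ (n + 1) * Wig1 hbar τ ψ φ z =
        τ * ((z.2 : ℂ) ^ n * Wig1 hbar τ (DS hbar ψ) φ z) +
        (1 - τ) * ((z.2 : ℂ) ^ n * Wig1 hbar τ ψ (DS hbar φ) z) := by
      rw [pow_succ, mul_assoc, wig_p hbar τ hhbar]; ring
    rw [this]
    refine (norm_add_le _ _).trans ?_
    rw [norm_mul (τ : ℂ), norm_mul (1 - τ : ℂ)]
    exact add_le_add (mul_le_mul_of_nonneg_left (h1' z) (norm_nonneg _))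
      (mul_le_mul_of_nonneg_left (h2' z) (norm_nonneg _))

lemma wig_integrable (hbar τ : ℝ) (hhbar : 0 < hbar) (n : ℕ) (ψ φ : SchwartzMap ℝ ℂ) :
    Integrable (fun z : ℝ × ℝ => (z.2 : ℂ) ^ n * Wig1 hbar τ ψ φ z) := by
  obtain ⟨B1, h1, h1'⟩ := wig_p_dom hbar τ hhbar n ψ φ
  obtain ⟨B2, h2, h2'⟩ := wig_p_dom hbar τ hhbar (n + 2) ψ φ
  have hd : Integrable (fun z : ℝ × ℝ => (B1 z.1 + B2 z.1) * (1 + z.2 ^ 2)⁻¹) :=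
    (h1.add h2).mul_prod integrable_inv_one_add_sq
  refine hd.mono' ?_ (Filter.Eventually.of_forall fun z => ?_)
  · refine AEStronglyMeasurable.mul ?_ (wig_stronglyMeasurable hbar τ ψ φ).aestronglyMeasurable
    exact Continuous.aestronglyMeasurable (by fun_prop)
  · have hpos : 0 < 1 + z.2 ^ 2 := by positivity
    rw [← div_eq_mul_inv, le_div_iff₀ hpos]
    have e : ‖(z.2 : ℂ) ^ (n + 2) * Wig1 hbar τ ψ φ z‖ =
        z.2 ^ 2 * ‖(z.2 : ℂ) ^ n * Wig1 hbar τ ψ φ z‖ := by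
      rw [pow_add, norm_mul, norm_mul, norm_mul, norm_pow (z.2 : ℂ) 2, Complex.norm_real,
        Real.norm_eq_abs, sq_abs]
      ring
    have a1 := h1' z
    have a2 := h2' z
    rw [e] at a2
    linarith

lemma wig_integral_zero (hbar τ : ℝ) (hhbar : 0 < hbar) (ψ φ : SchwartzMap ℝ ℂ) :
    ∫ z : ℝ × ℝ, Wig1 hbar τ ψ φ z = ∫ x, ψ x * (starRingEnd ℂ) (φ x) := by
  have hi : Integrable (fun z : ℝ × ℝ => Wig1 hbar τ ψ φ z) := by
    simpa using wig_integrable hbar τ hhbar 0 ψ φ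
  have hi' : Integrable (fun z : ℝ × ℝ => Wig1 hbar τ ψ φ z) (volume.prod volume) := hi
  rw [Measure.volume_eq_prod, integral_prod _ hi']
  refine integral_congr_ae ?_
  have hc : 0 < 2 * Real.pi * hbar := by positivity
  filter_upwards [hi'.prod_right_ae] with x hx
  simp only [wig_eq_fourier hbar τ hhbar] at hx ⊢
  have hcc : ((2 * Real.pi * hbar : ℝ) : ℂ) ≠ 0 := by exact_mod_cast hc.ne'
  have hF : Integrable (FourierTransform.fourier (gsec τ ψ φ x)) := by
    have h1 := hx.const_mul ((2 * Real.pi * hbar : ℝ) : ℂ)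
    simp only [mul_inv_cancel_left₀ hcc] at h1
    exact (integrable_comp_div_iff _ hc.ne').1 h1
  have inv := (gsec_integrable τ ψ φ x).fourierInv_fourier_eq hF
    (v := 0) (gsec_continuous_right τ ψ φ x).continuousAt
  rw [Real.fourierInv_eq'] at inv
  simp only [inner_zero_right, mul_zero, Complex.ofReal_zero, zero_mul, Complex.exp_zero,
    one_smul] at inv
  rw [integral_const_mul, Measure.integral_comp_div (FourierTransform.fourier (gsec τ ψ φ x)),
    inv, abs_of_pos hc, Complex.real_smul, inv_mul_cancel_left₀ hcc]
  simp [gsec]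

lemma pair_integrable (ψ φ : SchwartzMap ℝ ℂ) :
    Integrable (fun x => ψ x * (starRingEnd ℂ) (φ x)) := by
  obtain ⟨C, hC⟩ := schwartz_bdd ψ
  exact (schwartz_conj_integrable φ).bdd_mul (c := C) ψ.continuous.aestronglyMeasurable
    (Filter.Eventually.of_forall hC)

lemma DS_symm (hbar : ℝ) (ψ φ : SchwartzMap ℝ ℂ) :
    ∫ x, ψ x * (starRingEnd ℂ) (DS hbar φ x) = ∫ x, DS hbar ψ x * (starRingEnd ℂ) (φ x) := by
  have h := integral_mul_deriv_eq_deriv_mul_of_integrable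
    (u := ψ) (v := fun x => (starRingEnd ℂ) (φ x)) (u' := deriv ψ)
    (v' := fun x => (starRingEnd ℂ) (deriv φ x))
    (fun x _ => schwartz_hasDerivAt ψ x) (fun x _ => conj_hasDerivAt φ x)
    (pair_integrable ψ (SchwartzMap.derivCLM ℂ ℂ φ))
    (pair_integrable (SchwartzMap.derivCLM ℂ ℂ ψ) φ) (pair_integrable ψ φ)
  have e1 : ∀ x, ψ x * (starRingEnd ℂ) (DS hbar φ x) =
      (Complex.I * hbar) * (ψ x * (starRingEnd ℂ) (deriv φ x)) := by
    intro x
    simp only [DS_coe, Dop, map_mul, map_neg, Complex.conj_I, Complex.conj_ofReal]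
    ring
  have e2 : ∀ x, DS hbar ψ x * (starRingEnd ℂ) (φ x) =
      (-Complex.I * hbar) * (deriv ψ x * (starRingEnd ℂ) (φ x)) := by
    intro x
    simp only [DS_coe, Dop]
    ring
  simp only [e1, e2, integral_const_mul, h]
  ring

lemma wig_integral (hbar τ : ℝ) (hhbar : 0 < hbar) (n : ℕ) (ψ φ : SchwartzMap ℝ ℂ) :
    ∫ z : ℝ × ℝ, (z.2 : ℂ) ^ n * Wig1 hbar τ ψ φ z =
      ∫ x, (DS hbar)^[n] ψ x * (starRingEnd ℂ) (φ x) := by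
  induction n generalizing ψ φ with
  | zero => simpa using wig_integral_zero hbar τ hhbar ψ φ
  | succ n ih =>
    have : ∀ z : ℝ × ℝ, (z.2 : ℂ) ^ (n + 1) * Wig1 hbar τ ψ φ z =
        τ * ((z.2 : ℂ) ^ n * Wig1 hbar τ (DS hbar ψ) φ z) +
        (1 - τ) * ((z.2 : ℂ) ^ n * Wig1 hbar τ ψ (DS hbar φ) z) := by
      intro z
      rw [pow_succ, mul_assoc, wig_p hbar τ hhbar]; ring
    simp only [this]
    rw [integral_add ((wig_integrable hbar τ hhbar n _ _).const_mul _)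
      ((wig_integrable hbar τ hhbar n _ _).const_mul _), integral_const_mul, integral_const_mul,
      ih, ih, DS_symm, ← Function.iterate_succ_apply, ← Function.iterate_succ_apply' (DS hbar)]
    ring

/-- Multiplication by `x^j` on Schwartz functions. -/
def XS (j : ℕ) (f : SchwartzMap ℝ ℂ) : SchwartzMap ℝ ℂ :=
  SchwartzMap.smulLeftCLM ℂ (fun x : ℝ => (x : ℂ) ^ j) f

lemma XS_apply (j : ℕ) (f : SchwartzMap ℝ ℂ) (x : ℝ) : XS j f x = (x : ℂ) ^ j * f x := by
  unfold XS
  rw [SchwartzMap.smulLeftCLM_apply_apply, smul_eq_mul]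
  have : Function.HasTemperateGrowth (fun x : ℝ => (x : ℂ)) :=
    Complex.ofRealCLM.hasTemperateGrowth
  fun_prop

lemma wig_exp_integrable (hbar τ : ℝ) (ψ φ : SchwartzMap ℝ ℂ) (z : ℝ × ℝ) :
    Integrable (fun y : ℝ => Complex.exp (-Complex.I * (z.2 : ℂ) * (y : ℂ) / (hbar : ℂ)) *
      ψ (z.1 + τ * y) * (starRingEnd ℂ) (φ (z.1 - (1 - τ) * y))) := by
  simp only [mul_assoc]
  refine (gsec_integrable τ ψ φ z.1).bdd_mul (c := 1) ?_ ?_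
  · exact Continuous.aestronglyMeasurable (by fun_prop)
  · refine Filter.Eventually.of_forall fun y => ?_
    have : -Complex.I * ((z.2 : ℂ) * ((y : ℂ) / (hbar : ℂ))) =
        ((-(z.2 * y / hbar) : ℝ) : ℂ) * Complex.I := by
      push_cast; ring
    have h2 : -Complex.I * ((z.2 : ℂ) * (y : ℂ)) / (hbar : ℂ) =
        ((-(z.2 * y / hbar) : ℝ) : ℂ) * Complex.I := by
      push_cast; ring
    first
      | rw [this, Complex.norm_exp_ofReal_mul_I]
      | rw [h2, Complex.norm_exp_ofReal_mul_I]

lemma wig_x (hbar τ : ℝ) (m : ℕ) (ψ φ : SchwartzMap ℝ ℂ) (z : ℝ × ℝ) :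
    (z.1 : ℂ) ^ m * Wig1 hbar τ ψ φ z = ∑ k ∈ Finset.range (m + 1),
      (m.choose k : ℂ) * (τ : ℂ) ^ k * ((1 - τ : ℝ) : ℂ) ^ (m - k) *
        Wig1 hbar τ (XS (m - k) ψ) (XS k φ) z := by
  unfold Wig1
  have : ∀ k ∈ Finset.range (m + 1), (m.choose k : ℂ) * (τ : ℂ) ^ k *
      ((1 - τ : ℝ) : ℂ) ^ (m - k) * (((2 * Real.pi * hbar : ℝ) : ℂ)⁻¹ *
    ∫ y : ℝ, Complex.exp (-Complex.I * (z.2 : ℂ) * (y : ℂ) / (hbar : ℂ)) *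
      XS (m - k) ψ (z.1 + τ * y) * (starRingEnd ℂ) (XS k φ (z.1 - (1 - τ) * y))) =
      ((2 * Real.pi * hbar : ℝ) : ℂ)⁻¹ * ∫ y : ℝ, (m.choose k : ℂ) * (τ : ℂ) ^ k *
      ((1 - τ : ℝ) : ℂ) ^ (m - k) *
      (Complex.exp (-Complex.I * (z.2 : ℂ) * (y : ℂ) / (hbar : ℂ)) *
      XS (m - k) ψ (z.1 + τ * y) * (starRingEnd ℂ) (XS k φ (z.1 - (1 - τ) * y))) := by
    intro k _
    rw [integral_const_mul]
    ring
  rw [Finset.sum_congr rfl this, ← Finset.mul_sum, ← integral_finsetSum, mul_left_comm,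
    ← integral_const_mul]
  · congr 1
    refine integral_congr_ae (Filter.Eventually.of_forall fun y => ?_)
    have hx : (z.1 : ℂ) = τ * (z.1 - (1 - τ) * y) + (1 - τ) * (z.1 + τ * y) := by ring
    have hb : (z.1 : ℂ) ^ m = ∑ k ∈ Finset.range (m + 1),
        (τ * (z.1 - (1 - τ) * y) : ℂ) ^ k * ((1 - τ) * (z.1 + τ * y) : ℂ) ^ (m - k) *
          (m.choose k : ℂ) := by
      rw [← add_pow, ← hx]
    simp only []
    rw [hb, Finset.sum_mul]
    refine Finset.sum_congr rfl fun k _ => ?_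
    simp only [XS_apply, map_mul, map_pow, Complex.conj_ofReal]
    push_cast
    rw [mul_pow, mul_pow]
    ring
  · intro k _
    exact (wig_exp_integrable hbar τ _ _ z).const_mul _

/-- `τ`-quantization of monomials, first form:
`Op_τ(x^m p^n) = Σ_{k=0}^m C(m,k) τ^k (1−τ)^{m−k} x̂^k p̂^n x̂^{m−k}`,
expressed through the pairing with the `τ`-Wigner transform. -/
theorem stmt_3 (hbar : ℝ) (hhbar : 0 < hbar) (m n : ℕ) (τ : ℝ)
    (ψ φ : SchwartzMap ℝ ℂ) :
    ∫ z : ℝ × ℝ, (z.1 : ℂ) ^ m * (z.2 : ℂ) ^ n * Wig1 hbar τ (⇑ψ) (⇑φ) z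
      = ∑ k ∈ Finset.range (m + 1),
          (m.choose k : ℂ) * (τ : ℂ) ^ k * ((1 - τ : ℝ) : ℂ) ^ (m - k) *
            ∫ x : ℝ, (x : ℂ) ^ k *
              ((Dop hbar)^[n] (fun y => (y : ℂ) ^ (m - k) * ψ y)) x *
              (starRingEnd ℂ) (φ x) := by
  have h1 : ∀ z : ℝ × ℝ, (z.1 : ℂ) ^ m * (z.2 : ℂ) ^ n * Wig1 hbar τ (⇑ψ) (⇑φ) z =
      ∑ k ∈ Finset.range (m + 1),
        (m.choose k : ℂ) * (τ : ℂ) ^ k * ((1 - τ : ℝ) : ℂ) ^ (m - k) *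
          ((z.2 : ℂ) ^ n * Wig1 hbar τ (XS (m - k) ψ) (XS k φ) z) := by
    intro z
    rw [mul_right_comm, wig_x, Finset.sum_mul]
    refine Finset.sum_congr rfl fun k _ => ?_
    ring
  simp only [h1]
  rw [integral_finsetSum]
  · refine Finset.sum_congr rfl fun k _ => ?_
    rw [integral_const_mul, wig_integral hbar τ hhbar]
    congr 1
    have e : (fun y : ℝ => (y : ℂ) ^ (m - k) * ψ y) = ⇑(XS (m - k) ψ) :=
      funext fun y => (XS_apply _ _ _).symm
    rw [e, DS_iter]
    refine integral_congr_ae (Filter.Eventually.of_forall fun x => ?_)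
    simp only [XS_apply, map_mul, map_pow, Complex.conj_ofReal]
    ring
  · intro k _
    exact (wig_integrable hbar τ hhbar n _ _).const_mul _
end
end

section
/- Quantization of the symbol p·𝒜(x) (dimension N = 1): for every real number τ, every Schwartz function 𝒜 on ℝ, and all Schwartz functions ψ, φ on ℝ, ∫_{ℝ²} p·𝒜(x) · W_τ(ψ,φ)(x,p) dx dp = ∫_ℝ (−iħ)·( (1−τ)·(𝒜ψ)′(x) + τ·𝒜(x)ψ′(x) ) · conj(φ(x)) dx; in particular both the Weyl case τ = 1/2 and the average over τ ∈ [0,1] (Born–Jordan) give the operator ψ ↦ −(iħ/2)((𝒜ψ)′ + 𝒜ψ′). -/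
open MeasureTheory Complex

noncomputable section

/-- The integrand `ψ(x+τy) χ(x-(1-τ)y)` of the Wigner transform. -/
def wF (τ : ℝ) (ψ χ : SchwartzMap ℝ ℂ) (x y : ℝ) : ℂ :=
  ψ (x + τ * y) * χ (x - (1 - τ) * y)

/-- The unnormalized Wigner transform. -/
def wP (hbar τ : ℝ) (ψ χ : SchwartzMap ℝ ℂ) (z : ℝ × ℝ) : ℂ :=
  ∫ y : ℝ, Complex.exp (-Complex.I * (z.2 : ℂ) * (y : ℂ) / (hbar : ℂ)) * wF τ ψ χ z.1 y

lemma schwartz_bound (f : SchwartzMap ℝ ℂ) : ∃ C, 0 ≤ C ∧ ∀ x, (1 + x ^ 2) * ‖f x‖ ≤ C := by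
  refine ⟨SchwartzMap.seminorm ℝ 0 0 f + SchwartzMap.seminorm ℝ 2 0 f, by positivity, fun x => ?_⟩
  have h0 := SchwartzMap.norm_pow_mul_le_seminorm ℝ f 0 x
  have h2 := SchwartzMap.norm_pow_mul_le_seminorm ℝ f 2 x
  simp only [pow_zero, one_mul, Real.norm_eq_abs, sq_abs] at h0 h2
  linarith

lemma wF_bound (τ : ℝ) (ψ χ : SchwartzMap ℝ ℂ) :
    ∃ C, 0 ≤ C ∧ ∀ x y, ‖wF τ ψ χ x y‖ ≤ C * (1 + y ^ 2)⁻¹ := by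
  obtain ⟨C, hC, h⟩ := schwartz_bound ψ
  obtain ⟨D, hD, k⟩ := schwartz_bound χ
  refine ⟨2 * (C * D), by positivity, fun x y => ?_⟩
  rw [← div_eq_mul_inv, le_div_iff₀ (by positivity), wF, norm_mul]
  have h1 := h (x + τ * y)
  have k1 := k (x - (1 - τ) * y)
  have hm := mul_le_mul h1 k1 (by positivity) hC
  generalize hu : x + τ * y = u at *
  generalize hv : x - (1 - τ) * y = v at *
  have hy : y = u - v := by rw [← hu, ← hv]; ring
  have h3 : 1 + y ^ 2 ≤ 2 * ((1 + u ^ 2) * (1 + v ^ 2)) := by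
    rw [hy]; nlinarith [sq_nonneg (u + v), sq_nonneg (u * v)]
  calc ‖ψ u‖ * ‖χ v‖ * (1 + y ^ 2) ≤ ‖ψ u‖ * ‖χ v‖ * (2 * ((1 + u ^ 2) * (1 + v ^ 2))) := by
        gcongr
    _ = 2 * ((1 + u ^ 2) * ‖ψ u‖ * ((1 + v ^ 2) * ‖χ v‖)) := by ring
    _ ≤ _ := by linarith

lemma wF_cont (τ : ℝ) (ψ χ : SchwartzMap ℝ ℂ) :
    Continuous (fun q : ℝ × ℝ => wF τ ψ χ q.1 q.2) := by
  have h1 := ψ.continuous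
  have h2 := χ.continuous
  unfold wF
  fun_prop

lemma wF_cont' (τ : ℝ) (ψ χ : SchwartzMap ℝ ℂ) (x : ℝ) : Continuous (wF τ ψ χ x) :=
  (wF_cont τ ψ χ).comp (by fun_prop : Continuous fun y : ℝ => (x, y))

lemma wF_int (τ : ℝ) (ψ χ : SchwartzMap ℝ ℂ) (x : ℝ) : Integrable (wF τ ψ χ x) := by
  obtain ⟨C, hC, h⟩ := wF_bound τ ψ χ
  exact (integrable_inv_one_add_sq.const_mul C).mono' (wF_cont' τ ψ χ x).aestronglyMeasurable
    (Filter.Eventually.of_forall (h x))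

lemma norm_ker (hbar p y : ℝ) :
    ‖Complex.exp (-Complex.I * (p : ℂ) * (y : ℂ) / (hbar : ℂ))‖ = 1 := by
  have : -Complex.I * (p : ℂ) * (y : ℂ) / (hbar : ℂ) = ((-(p * y / hbar) : ℝ) : ℂ) * Complex.I := by
    push_cast; ring
  rw [this, Complex.norm_exp_ofReal_mul_I]

lemma ker_int (hbar τ : ℝ) (ψ χ : SchwartzMap ℝ ℂ) (x p : ℝ) :
    Integrable (fun y : ℝ => Complex.exp (-Complex.I * (p : ℂ) * (y : ℂ) / (hbar : ℂ)) *
      wF τ ψ χ x y) := by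
  refine (wF_int τ ψ χ x).norm.mono' ?_ (Filter.Eventually.of_forall fun y => ?_)
  · exact ((by fun_prop : Continuous fun y : ℝ =>
      Complex.exp (-Complex.I * (p : ℂ) * (y : ℂ) / (hbar : ℂ))).mul
        (wF_cont' τ ψ χ x)).aestronglyMeasurable
  · rw [norm_mul, norm_ker, one_mul]

lemma wF_deriv (τ : ℝ) (ψ χ : SchwartzMap ℝ ℂ) (x y : ℝ) :
    HasDerivAt (wF τ ψ χ x)
      ((τ : ℂ) * wF τ (SchwartzMap.derivCLM ℂ ℂ ψ) χ x y -
        ((1 - τ : ℝ) : ℂ) * wF τ ψ (SchwartzMap.derivCLM ℂ ℂ χ) x y) y := by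
  have h1 : HasDerivAt (fun y : ℝ => x + τ * y) τ y := by
    simpa using ((hasDerivAt_id y).const_mul τ).const_add x
  have h2 : HasDerivAt (fun y : ℝ => x - (1 - τ) * y) (-(1 - τ)) y := by
    simpa using ((hasDerivAt_id y).const_mul (1 - τ)).const_sub x
  have h3 := (ψ.differentiableAt (x := x + τ * y)).hasDerivAt.scomp y h1
  have h4 := (χ.differentiableAt (x := x - (1 - τ) * y)).hasDerivAt.scomp y h2
  refine (h3.mul h4).congr_deriv ?_
  simp only [wF, SchwartzMap.derivCLM_apply, Function.comp, Complex.real_smul]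
  push_cast
  ring

lemma wP_mul (hbar : ℝ) (hh : 0 < hbar) (τ : ℝ) (ψ χ : SchwartzMap ℝ ℂ) (z : ℝ × ℝ) :
    (z.2 : ℂ) * wP hbar τ ψ χ z = -Complex.I * (hbar : ℂ) *
      ((τ : ℂ) * wP hbar τ (SchwartzMap.derivCLM ℂ ℂ ψ) χ z -
        ((1 - τ : ℝ) : ℂ) * wP hbar τ ψ (SchwartzMap.derivCLM ℂ ℂ χ) z) := by
  obtain ⟨x, p⟩ := z
  have hb : (hbar : ℂ) ≠ 0 := by exact_mod_cast hh.ne'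
  set e : ℝ → ℂ := fun y => Complex.exp (-Complex.I * (p : ℂ) * (y : ℂ) / (hbar : ℂ)) with he
  have hE : ∀ y : ℝ, HasDerivAt e (-Complex.I * p / hbar * e y) y := by
    intro y
    have h1 : HasDerivAt (fun y : ℝ => -Complex.I * (p : ℂ) * (y : ℂ) / (hbar : ℂ))
        (-Complex.I * p * 1 / hbar) y :=
      ((Complex.ofRealCLM.hasDerivAt (x := y)).const_mul _).div_const _
    refine h1.cexp.congr_deriv ?_
    simp only [he]; ring
  have i1 := (ker_int hbar τ (SchwartzMap.derivCLM ℂ ℂ ψ) χ x p).const_mul (τ : ℂ)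
  have i2 := (ker_int hbar τ ψ (SchwartzMap.derivCLM ℂ ℂ χ) x p).const_mul ((1 - τ : ℝ) : ℂ)
  have i3 := ker_int hbar τ ψ χ x p
  have key := integral_mul_deriv_eq_deriv_mul_of_integrable (u := e) (v := wF τ ψ χ x)
    (fun y _ => hE y) (fun y _ => wF_deriv τ ψ χ x y)
    ((i1.sub i2).congr (Filter.Eventually.of_forall fun y => by
      simp only [Pi.sub_apply, Pi.mul_apply, he]; ring))
    ((i3.const_mul (-Complex.I * p / hbar)).congr (Filter.Eventually.of_forall fun y => by
      simp only [Pi.mul_apply, he]; ring)) i3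
  have l : ∫ y, e y * ((τ : ℂ) * wF τ (SchwartzMap.derivCLM ℂ ℂ ψ) χ x y -
        ((1 - τ : ℝ) : ℂ) * wF τ ψ (SchwartzMap.derivCLM ℂ ℂ χ) x y) =
      (τ : ℂ) * wP hbar τ (SchwartzMap.derivCLM ℂ ℂ ψ) χ (x, p) -
        ((1 - τ : ℝ) : ℂ) * wP hbar τ ψ (SchwartzMap.derivCLM ℂ ℂ χ) (x, p) := by
    rw [wP, wP, ← integral_const_mul, ← integral_const_mul, ← integral_sub i1 i2]
    congr 1; ext y; simp only [he]; ring
  have r : ∫ y, -Complex.I * p / hbar * e y * wF τ ψ χ x y =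
      -Complex.I * p / hbar * wP hbar τ ψ χ (x, p) := by
    rw [wP, ← integral_const_mul]
    congr 1; ext y; simp only [he]; ring
  rw [l, r] at key
  rw [key]
  field_simp
  linear_combination ((p : ℂ) * wP hbar τ ψ χ (x, p)) * Complex.I_sq

lemma wP_bound (hbar : ℝ) (hh : 0 < hbar) (τ : ℝ) (n : ℕ) : ∀ (ψ χ : SchwartzMap ℝ ℂ),
    ∃ C, 0 ≤ C ∧ ∀ z : ℝ × ℝ, |z.2| ^ n * ‖wP hbar τ ψ χ z‖ ≤ C := by
  induction n with
  | zero =>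
    intro ψ χ
    obtain ⟨C, hC, h⟩ := wF_bound τ ψ χ
    refine ⟨∫ y : ℝ, C * (1 + y ^ 2)⁻¹, integral_nonneg fun y => by positivity, fun z => ?_⟩
    rw [pow_zero, one_mul]
    refine norm_integral_le_of_norm_le (integrable_inv_one_add_sq.const_mul C)
      (Filter.Eventually.of_forall fun y => ?_)
    rw [norm_mul, norm_ker, one_mul]
    exact h _ _
  | succ n ih =>
    intro ψ χ
    obtain ⟨C, hC, h⟩ := ih (SchwartzMap.derivCLM ℂ ℂ ψ) χ
    obtain ⟨D, hD, k⟩ := ih ψ (SchwartzMap.derivCLM ℂ ℂ χ)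
    refine ⟨hbar * (|τ| * C + |1 - τ| * D), by positivity, fun z => ?_⟩
    have e : |z.2| ^ (n + 1) * ‖wP hbar τ ψ χ z‖ = |z.2| ^ n * ‖(z.2 : ℂ) * wP hbar τ ψ χ z‖ := by
      rw [norm_mul, Complex.norm_real, Real.norm_eq_abs]; ring
    rw [e, wP_mul hbar hh, norm_mul, norm_mul, norm_neg, Complex.norm_I, one_mul,
      Complex.norm_real, Real.norm_eq_abs, abs_of_pos hh]
    have t := norm_sub_le ((τ : ℂ) * wP hbar τ (SchwartzMap.derivCLM ℂ ℂ ψ) χ z)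
      (((1 - τ : ℝ) : ℂ) * wP hbar τ ψ (SchwartzMap.derivCLM ℂ ℂ χ) z)
    rw [norm_mul, norm_mul, Complex.norm_real, Complex.norm_real, Real.norm_eq_abs,
      Real.norm_eq_abs] at t
    calc _ ≤ |z.2| ^ n * (hbar * (|τ| * ‖wP hbar τ (SchwartzMap.derivCLM ℂ ℂ ψ) χ z‖ +
            |1 - τ| * ‖wP hbar τ ψ (SchwartzMap.derivCLM ℂ ℂ χ) z‖)) := by gcongr
      _ = hbar * (|τ| * (|z.2| ^ n * ‖wP hbar τ (SchwartzMap.derivCLM ℂ ℂ ψ) χ z‖) +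
            |1 - τ| * (|z.2| ^ n * ‖wP hbar τ ψ (SchwartzMap.derivCLM ℂ ℂ χ) z‖)) := by ring
      _ ≤ _ := by
        have := h z
        have := k z
        gcongr

lemma wP_bound' (hbar : ℝ) (hh : 0 < hbar) (τ : ℝ) (ψ χ : SchwartzMap ℝ ℂ) :
    ∃ C, 0 ≤ C ∧ ∀ z : ℝ × ℝ, ‖wP hbar τ ψ χ z‖ ≤ C * (1 + z.2 ^ 2)⁻¹ := by
  obtain ⟨C, hC, h⟩ := wP_bound hbar hh τ 0 ψ χ
  obtain ⟨D, hD, k⟩ := wP_bound hbar hh τ 2 ψ χ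
  refine ⟨C + D, by positivity, fun z => ?_⟩
  rw [← div_eq_mul_inv, le_div_iff₀ (by positivity)]
  have h1 := h z
  have h2 := k z
  rw [pow_zero, one_mul] at h1
  rw [sq_abs] at h2
  linarith

lemma wP_meas (hbar τ : ℝ) (ψ χ : SchwartzMap ℝ ℂ) : StronglyMeasurable (wP hbar τ ψ χ) := by
  unfold wP
  refine StronglyMeasurable.integral_prod_right'
    (f := fun q : (ℝ × ℝ) × ℝ => Complex.exp (-Complex.I * (q.1.2 : ℂ) * (q.2 : ℂ) / (hbar : ℂ)) *
      wF τ ψ χ q.1.1 q.2) ?_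
  exact ((by fun_prop : Continuous fun q : (ℝ × ℝ) × ℝ =>
      Complex.exp (-Complex.I * (q.1.2 : ℂ) * (q.2 : ℂ) / (hbar : ℂ))).mul
        ((wF_cont τ ψ χ).comp (by fun_prop : Continuous fun q : (ℝ × ℝ) × ℝ =>
          (q.1.1, q.2)))).stronglyMeasurable

lemma wP_int (hbar : ℝ) (hh : 0 < hbar) (τ : ℝ) (B ψ χ : SchwartzMap ℝ ℂ) :
    Integrable (fun z : ℝ × ℝ => B z.1 * wP hbar τ ψ χ z) := by
  obtain ⟨C, hC, h⟩ := wP_bound' hbar hh τ ψ χ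
  have hI : Integrable (fun z : ℝ × ℝ => ‖B z.1‖ * (C * (1 + z.2 ^ 2)⁻¹)) :=
    Integrable.mul_prod (f := fun x => ‖B x‖) (g := fun p : ℝ => C * (1 + p ^ 2)⁻¹)
      B.integrable.norm (integrable_inv_one_add_sq.const_mul C)
  refine hI.mono' ?_ (Filter.Eventually.of_forall fun z => ?_)
  · exact ((B.continuous.comp continuous_fst).stronglyMeasurable.mul
      (wP_meas hbar τ ψ χ)).aestronglyMeasurable
  · rw [norm_mul]
    gcongr
    exact h z

lemma wP_marginal (hbar : ℝ) (hh : 0 < hbar) (τ : ℝ) (ψ χ : SchwartzMap ℝ ℂ) (x : ℝ) :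
    ∫ p : ℝ, wP hbar τ ψ χ (x, p) = ((2 * Real.pi * hbar : ℝ) : ℂ) * (ψ x * χ x) := by
  have hb : (hbar : ℂ) ≠ 0 := by exact_mod_cast hh.ne'
  have hc : 0 < 2 * Real.pi * hbar := by positivity
  have hF : FourierTransform.fourier (wF τ ψ χ x) =
      fun ξ : ℝ => wP hbar τ ψ χ (x, ξ * (2 * Real.pi * hbar)) := by
    ext ξ
    rw [Real.fourier_real_eq_integral_exp_smul, wP]
    congr 1; ext y
    rw [smul_eq_mul]
    congr 2
    push_cast
    field_simp
  obtain ⟨C, hC, h⟩ := wP_bound' hbar hh τ ψ χ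
  have hi : Integrable (fun p : ℝ => wP hbar τ ψ χ (x, p)) := by
    refine (integrable_inv_one_add_sq.const_mul C).mono' ?_
      (Filter.Eventually.of_forall fun p => h (x, p))
    exact ((wP_meas hbar τ ψ χ).comp_measurable (by fun_prop)).aestronglyMeasurable
  have hi' : Integrable (FourierTransform.fourier (wF τ ψ χ x)) := by
    rw [hF]
    exact hi.comp_mul_right' hc.ne'
  have inv := (wF_int τ ψ χ x).fourierInv_fourier_eq hi' (v := 0) (wF_cont' τ ψ χ x).continuousAt
  rw [Real.fourierInv_eq', hF] at inv
  simp only [inner_zero_right, mul_zero, Complex.ofReal_zero, zero_mul, Complex.exp_zero,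
    one_smul] at inv
  rw [Measure.integral_comp_mul_right (fun p : ℝ => wP hbar τ ψ χ (x, p))] at inv
  have h0 : wF τ ψ χ x 0 = ψ x * χ x := by simp [wF]
  rw [h0, abs_of_pos (inv_pos.2 hc), Complex.real_smul] at inv
  rw [← inv, ← mul_assoc, ← Complex.ofReal_mul, mul_inv_cancel₀ hc.ne']
  simp

lemma wP_pair (hbar : ℝ) (hh : 0 < hbar) (τ : ℝ) (B ψ χ : SchwartzMap ℝ ℂ) :
    ∫ z : ℝ × ℝ, B z.1 * wP hbar τ ψ χ z =
      ((2 * Real.pi * hbar : ℝ) : ℂ) * ∫ x : ℝ, B x * ψ x * χ x := by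
  rw [Measure.volume_eq_prod, integral_prod _ (wP_int hbar hh τ B ψ χ), ← integral_const_mul]
  congr 1; ext x
  simp only
  rw [integral_const_mul, wP_marginal hbar hh]
  ring

/-- product of Schwartz functions -/
def sMul (f g : SchwartzMap ℝ ℂ) : SchwartzMap ℝ ℂ :=
  SchwartzMap.smulLeftCLM ℂ f g

lemma sMul_apply (f g : SchwartzMap ℝ ℂ) (x : ℝ) : sMul f g x = f x * g x := by
  rw [sMul, SchwartzMap.smulLeftCLM_apply_apply f.hasTemperateGrowth, smul_eq_mul]

lemma main_formula (hbar : ℝ) (hh : 0 < hbar) (τ : ℝ) (B ψ χ : SchwartzMap ℝ ℂ) :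
    ∫ z : ℝ × ℝ, (z.2 : ℂ) * B z.1 * (((2 * Real.pi * hbar : ℝ) : ℂ)⁻¹ * wP hbar τ ψ χ z) =
      -Complex.I * (hbar : ℂ) * (((1 - τ : ℝ) : ℂ) * (∫ x : ℝ, deriv (sMul B ψ) x * χ x) +
        (τ : ℂ) * ∫ x : ℝ, B x * deriv ψ x * χ x) := by
  have hc : ((2 * Real.pi * hbar : ℝ) : ℂ) ≠ 0 := by
    exact_mod_cast (by positivity : 0 < 2 * Real.pi * hbar).ne'
  set c := ((2 * Real.pi * hbar : ℝ) : ℂ)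
  have i1 := (wP_int hbar hh τ B (SchwartzMap.derivCLM ℂ ℂ ψ) χ).const_mul
    (c⁻¹ * (-Complex.I * (hbar : ℂ)) * (τ : ℂ))
  have i2 := (wP_int hbar hh τ B ψ (SchwartzMap.derivCLM ℂ ℂ χ)).const_mul
    (c⁻¹ * (-Complex.I * (hbar : ℂ)) * ((1 - τ : ℝ) : ℂ))
  have e : ∀ z : ℝ × ℝ, (z.2 : ℂ) * B z.1 * (c⁻¹ * wP hbar τ ψ χ z) =
      (c⁻¹ * (-Complex.I * (hbar : ℂ)) * (τ : ℂ)) *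
        (B z.1 * wP hbar τ (SchwartzMap.derivCLM ℂ ℂ ψ) χ z) -
      (c⁻¹ * (-Complex.I * (hbar : ℂ)) * ((1 - τ : ℝ) : ℂ)) *
        (B z.1 * wP hbar τ ψ (SchwartzMap.derivCLM ℂ ℂ χ) z) := by
    intro z
    linear_combination (c⁻¹ * B z.1) * wP_mul hbar hh τ ψ χ z
  simp_rw [e]
  rw [integral_sub i1 i2, integral_const_mul, integral_const_mul, wP_pair hbar hh, wP_pair hbar hh]
  have parts := SchwartzMap.integral_mul_deriv_eq_neg_deriv_mul (sMul B ψ) χ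
  have p2 : ∫ x, B x * ψ x * SchwartzMap.derivCLM ℂ ℂ χ x = - ∫ x, deriv (sMul B ψ) x * χ x := by
    rw [← parts]
    simp only [sMul_apply, SchwartzMap.derivCLM_apply]
  rw [p2]
  simp only [SchwartzMap.derivCLM_apply]
  field_simp
  ring

lemma stmt_gen (hbar : ℝ) (hhbar : 0 < hbar) (A : SchwartzMap ℝ ℝ) (ψ φ : SchwartzMap ℝ ℂ) :
    ∃ I₁ I₂ : ℂ, (∀ τ : ℝ,
      ∫ z : ℝ × ℝ, (z.2 : ℂ) * ((A z.1 : ℝ) : ℂ) * Wig1 hbar τ (⇑ψ) (⇑φ) z =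
        -Complex.I * (hbar : ℂ) * (((1 - τ : ℝ) : ℂ) * I₁ + (τ : ℂ) * I₂)) ∧
      ∀ c a b : ℂ, ∫ x : ℝ, c *
          (a * deriv (fun y => ((A y : ℝ) : ℂ) * ψ y) x +
            b * ((A x : ℝ) : ℂ) * deriv (⇑ψ) x) * (starRingEnd ℂ) (φ x) =
        c * (a * I₁ + b * I₂) := by
  set B : SchwartzMap ℝ ℂ := A.postcompCLM Complex.ofRealCLM with hB
  set χ : SchwartzMap ℝ ℂ := φ.postcompCLM (Complex.conjCLE : ℂ →L[ℝ] ℂ) with hχ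
  have hBx : ∀ x, B x = ((A x : ℝ) : ℂ) := fun x => rfl
  have hχx : ∀ x, χ x = (starRingEnd ℂ) (φ x) := fun x => rfl
  have hs : (fun y => ((A y : ℝ) : ℂ) * ψ y) = sMul B ψ := by
    ext y; rw [sMul_apply, hBx]
  refine ⟨∫ x : ℝ, deriv (sMul B ψ) x * χ x, ∫ x : ℝ, B x * deriv ψ x * χ x, fun τ => ?_,
    fun c a b => ?_⟩
  · rw [← main_formula hbar hhbar]
    congr 1; ext z
    rw [Wig1, wP]
    simp only [wF, hBx, hχx, mul_assoc]
  · rw [hs]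
    simp only [← hBx, ← hχx]
    have i1 : Integrable (fun x : ℝ => deriv (sMul B ψ) x * χ x) := by
      refine (sMul (SchwartzMap.derivCLM ℂ ℂ (sMul B ψ)) χ).integrable.congr
        (Filter.Eventually.of_forall fun x => ?_)
      simp only [sMul_apply, SchwartzMap.derivCLM_apply]
    have i2 : Integrable (fun x : ℝ => B x * deriv ψ x * χ x) := by
      refine (sMul (sMul B (SchwartzMap.derivCLM ℂ ℂ ψ)) χ).integrable.congr
        (Filter.Eventually.of_forall fun x => ?_)
      simp only [sMul_apply, SchwartzMap.derivCLM_apply]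
    rw [mul_add, ← mul_assoc, ← mul_assoc, ← integral_const_mul, ← integral_const_mul,
      ← integral_add (i1.const_mul _) (i2.const_mul _)]
    congr 1; ext x; ring

/-- quantization of the symbol `p·𝒜(x)`:
`∫ p 𝒜(x) W_τ(ψ,φ) dxdp = ∫ (−iħ)((1−τ)(𝒜ψ)′(x) + τ 𝒜(x)ψ′(x)) conj(φ(x)) dx`;
in particular both the Weyl case `τ = 1/2` and the Born–Jordan average over
`τ ∈ [0,1]` give the operator `ψ ↦ −(iħ/2)((𝒜ψ)′ + 𝒜ψ′)`. -/
theorem stmt_17 (hbar : ℝ) (hhbar : 0 < hbar) (τ : ℝ)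
    (A : SchwartzMap ℝ ℝ) (ψ φ : SchwartzMap ℝ ℂ) :
    (∫ z : ℝ × ℝ, (z.2 : ℂ) * ((A z.1 : ℝ) : ℂ) * Wig1 hbar τ (⇑ψ) (⇑φ) z
      = ∫ x : ℝ, -Complex.I * (hbar : ℂ) *
          (((1 - τ : ℝ) : ℂ) * deriv (fun y => ((A y : ℝ) : ℂ) * ψ y) x +
            (τ : ℂ) * ((A x : ℝ) : ℂ) * deriv (⇑ψ) x) *
          (starRingEnd ℂ) (φ x))
    ∧
    (∫ z : ℝ × ℝ, (z.2 : ℂ) * ((A z.1 : ℝ) : ℂ) * Wig1 hbar (1 / 2) (⇑ψ) (⇑φ) z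
      = ∫ x : ℝ, -(Complex.I * (hbar : ℂ) / 2) *
          (deriv (fun y => ((A y : ℝ) : ℂ) * ψ y) x +
            ((A x : ℝ) : ℂ) * deriv (⇑ψ) x) *
          (starRingEnd ℂ) (φ x))
    ∧
    (∫ σ in (0:ℝ)..1,
        ∫ z : ℝ × ℝ, (z.2 : ℂ) * ((A z.1 : ℝ) : ℂ) * Wig1 hbar σ (⇑ψ) (⇑φ) z)
      = ∫ x : ℝ, -(Complex.I * (hbar : ℂ) / 2) *
          (deriv (fun y => ((A y : ℝ) : ℂ) * ψ y) x +
            ((A x : ℝ) : ℂ) * deriv (⇑ψ) x) *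
          (starRingEnd ℂ) (φ x) := by

  obtain ⟨I₁, I₂, h, k⟩ := stmt_gen hbar hhbar A ψ φ
  have k2 := k (-(Complex.I * (hbar : ℂ) / 2)) 1 1
  simp only [one_mul] at k2
  refine ⟨?_, ?_, ?_⟩
  · rw [h, k]
  · rw [h, k2]
    push_cast
    ring
  · simp only [h]
    rw [k2]
    have e : ∀ σ : ℝ, -Complex.I * (hbar : ℂ) * (((1 - σ : ℝ) : ℂ) * I₁ + (σ : ℂ) * I₂) =
        -Complex.I * (hbar : ℂ) * I₁ + (σ : ℂ) * (-Complex.I * (hbar : ℂ) * (I₂ - I₁)) := by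
      intro σ; push_cast; ring
    simp only [e]
    rw [intervalIntegral.integral_add (by simp)
      ((by fun_prop : Continuous fun σ : ℝ =>
        (σ : ℂ) * (-Complex.I * (hbar : ℂ) * (I₂ - I₁))).intervalIntegrable _ _),
      intervalIntegral.integral_const, intervalIntegral.integral_mul_const,
      intervalIntegral.integral_ofReal, integral_id]
    simp only [sub_zero, one_smul]
    push_cast
    ring
end
end
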